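/- arXiv:2104.01676 — 3 statements merged into one kernel-verified Lean document; each statement's English description precedes it below -/
import Mathlib

section
/- The kernel K_τ is reflection positive: its one-variable marginal K̂_τ is the Laplace transform of a nonnegative function, i.e. there exists a measurable function g : (0,∞) → [0,∞) such that K̂_τ(t) = ∫_0^∞ e^{−|t| s} g(s) ds for every t ∈ ℝ. -/
open MeasureTheory Real Set

noncomputable section

/-- Standard basis vector `e i` of `ℝ^d`. -/
def ee (d : ℕ) (i : Fin d) : Fin d → ℝ := fun j => if j = i then 1 else 0

/-- The `ℓ¹`-norm `‖y‖₁ = ∑ |y i|`. -/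
def norm1 {d : ℕ} (y : Fin d → ℝ) : ℝ := ∑ j, |y j|

/-- Double-well potential `W(t) = t²(1-t)²`. -/
def Wpot (t : ℝ) : ℝ := t ^ 2 * (1 - t) ^ 2

/-- `ω(t) = ∫₀ᵗ 6√W = 3t² − 2t³`. -/
def omegaFn (t : ℝ) : ℝ := 3 * t ^ 2 - 2 * t ^ 3

/-- The box `[0,L)^d`. -/
def cube (d : ℕ) (L : ℝ) : Set (Fin d → ℝ) := {x | ∀ j, x j ∈ Set.Ico (0 : ℝ) L}

/-- The cube of side `l` centered at `z` (w.r.t. the sup norm). -/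
def Qc (d : ℕ) (l : ℝ) (z : Fin d → ℝ) : Set (Fin d → ℝ) := {x | ∀ j, |x j - z j| ≤ l / 2}

/-- The perpendicular cube of side `l` centered at `zp`. -/
def Qperp (n : ℕ) (l : ℝ) (zp : Fin n → ℝ) : Set (Fin n → ℝ) := {w | ∀ j, |w j - zp j| ≤ l / 2}

/-- The kernel `K_τ(ζ) = (‖ζ‖₁ + τ^{1/β})^{-p}`. -/
def Ktau (d : ℕ) (p β τ : ℝ) (ζ : Fin d → ℝ) : ℝ := (norm1 ζ + τ ^ (1 / β)) ^ (-p)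

/-- The marginal `K̂_τ` of the kernel, integrating out `m` variables (for ambient dimension
`m+1` this is the one-variable marginal). -/
def Khat (m : ℕ) (p β τ : ℝ) (t : ℝ) : ℝ :=
  ∫ ζ : Fin m → ℝ, (|t| + norm1 ζ + τ ^ (1 / β)) ^ (-p)

/-- `C_τ = ∫ |t| K̂_τ(t) dt`. -/
def Ctau (m : ℕ) (p β τ : ℝ) : ℝ := ∫ t : ℝ, |t| * Khat m p β τ t

/-- Gradient vector of `u`. -/
def gradv {d : ℕ} (u : (Fin d → ℝ) → ℝ) (x : Fin d → ℝ) : Fin d → ℝ :=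
  fun j => fderiv ℝ u x (ee d j)

/-- `α_{ε,τ} = ε τ^{1/β}`. -/
def alphaET (β τ ε : ℝ) : ℝ := ε * τ ^ (1 / β)

/-- Modica–Mortola term on `[0,L)^d`. -/
def Malpha (d : ℕ) (α L : ℝ) (u : (Fin d → ℝ) → ℝ) : ℝ :=
  3 * α * (∫ x in cube d L, (norm1 (gradv u x)) ^ 2) +
    (3 / α) * (∫ x in cube d L, Wpot (u x))

/-- The rescaled functional `F_{τ,L,ε}` in dimension `d = n+1`. -/
def FF (n : ℕ) (p β τ ε L : ℝ) (u : (Fin (n + 1) → ℝ) → ℝ) : ℝ :=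
  (Malpha (n + 1) (alphaET β τ ε) L u *
        ((∫ ζ : Fin (n + 1) → ℝ, Ktau (n + 1) p β τ ζ * |ζ 0|) - 1) -
      ∫ ζ : Fin (n + 1) → ℝ, ∫ x in cube (n + 1) L, |u x - u (x + ζ)| ^ 2 * Ktau (n + 1) p β τ ζ) /
    L ^ (n + 1)

/-- `[0,L)^d`-periodicity. -/
def PeriodicCube (d : ℕ) (L : ℝ) (u : (Fin d → ℝ) → ℝ) : Prop :=
  ∀ (x : Fin d → ℝ) (j : Fin d), u (x + L • ee d j) = u x

/-- Admissible function: a `W^{1,2}_loc` representative with values in `[0,1]`. -/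
def Adm (d : ℕ) (u : (Fin d → ℝ) → ℝ) : Prop :=
  Differentiable ℝ u ∧ ∀ x, u x ∈ Set.Icc (0 : ℝ) 1

/-- Admissible and `[0,L)^d`-periodic. -/
def AdmPer (d : ℕ) (L : ℝ) (u : (Fin d → ℝ) → ℝ) : Prop := Adm d u ∧ PeriodicCube d L u

/-- One-dimensional function: `u(x) = g(x_i)`. -/
def OneD (d : ℕ) (u : (Fin d → ℝ) → ℝ) : Prop := ∃ i : Fin d, ∃ g : ℝ → ℝ, ∀ x, u x = g (x i)

/-- Minimizer of `F_{τ,L,ε}` among admissible `[0,L)^d`-periodic functions. -/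
def IsMinimizer (n : ℕ) (p β τ ε L : ℝ) (u : (Fin (n + 1) → ℝ) → ℝ) : Prop :=
  AdmPer (n + 1) L u ∧ ∀ v, AdmPer (n + 1) L v → FF n p β τ ε L u ≤ FF n p β τ ε L v

/-- `C*_{τ,ε}`: optimal energy density over one-dimensional periodic functions. -/
def Cstar (n : ℕ) (p β τ ε : ℝ) : ℝ :=
  sInf {c | ∃ L, 0 < L ∧ ∃ u, AdmPer (n + 1) L u ∧ OneD (n + 1) u ∧ c = FF n p β τ ε L u}

/-- `h` is an optimal half-period: `C*_{τ,ε}` is attained by a one-dimensional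
`[0,2h)^d`-periodic function. -/
def IsOptHalfPeriod (n : ℕ) (p β τ ε h : ℝ) : Prop :=
  0 < h ∧ ∃ u, AdmPer (n + 1) (2 * h) u ∧ OneD (n + 1) u ∧
    FF n p β τ ε (2 * h) u = Cstar n p β τ ε

/-- Slice of `u` in direction `i` at perpendicular coordinates `xp`. -/
def uslice {n : ℕ} (u : (Fin (n + 1) → ℝ) → ℝ) (i : Fin (n + 1)) (xp : Fin n → ℝ) (s : ℝ) : ℝ :=
  u (i.insertNth s xp)

/-- Sliced Modica–Mortola energy on a set `I` of the slice variable. -/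
def MbarSet (n : ℕ) (α : ℝ) (u : (Fin (n + 1) → ℝ) → ℝ) (i : Fin (n + 1)) (xp : Fin n → ℝ)
    (I : Set ℝ) : ℝ :=
  3 * α * (∫ ρ in I ∩ {ρ : ℝ | gradv u (i.insertNth ρ xp) ≠ 0},
      |gradv u (i.insertNth ρ xp) i| * norm1 (gradv u (i.insertNth ρ xp))) +
    (3 / α) * (∫ ρ in I ∩ {ρ : ℝ | gradv u (i.insertNth ρ xp) ≠ 0},
      Wpot (u (i.insertNth ρ xp)) * |gradv u (i.insertNth ρ xp) i| /
        norm1 (gradv u (i.insertNth ρ xp)))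

/-- Sliced Modica–Mortola energy on the interval with endpoints `s`, `t`. -/
def Mbar (n : ℕ) (α : ℝ) (u : (Fin (n + 1) → ℝ) → ℝ) (i : Fin (n + 1)) (xp : Fin n → ℝ)
    (s t : ℝ) : ℝ :=
  MbarSet n α u i xp (Set.uIcc s t)

/-- `Ω(a,b)`: pairs `(s,ρ)` such that the interval with endpoints `s, s+ρ` contains the
interval with endpoints `a, b`. -/
def OmegaST (L a b : ℝ) : Set (ℝ × ℝ) :=
  {sr | sr.1 ∈ Set.Icc (0 : ℝ) L ∧ Set.uIcc a b ⊆ Set.uIcc sr.1 (sr.1 + sr.2)}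

/-- `G(ρ) = |ρ| min(|ρ|, L)`. -/
def Gfun (L ρ : ℝ) : ℝ := |ρ| * min (|ρ|) L

/-- The localized term `R_{i,τ,ε}(u, x_i^⊥, I)`. -/
def Rloc (n : ℕ) (p β τ ε L : ℝ) (u : (Fin (n + 1) → ℝ) → ℝ) (i : Fin (n + 1))
    (xp : Fin n → ℝ) (I : Set ℝ) : ℝ :=
  -MbarSet n (alphaET β τ ε) u i xp I +
    ∫ a in I, ∫ b : ℝ, ∫ sr in OmegaST L a b,
      (Gfun L sr.2)⁻¹ *
          (Mbar n (alphaET β τ ε) u i xp sr.1 (sr.1 + sr.2) -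
            (uslice u i xp sr.1 - uslice u i xp (sr.1 + sr.2)) ^ 2) *
        Khat n p β τ sr.2

/-- `f_u(x_i^⊥, s, y_i^⊥, t)`. -/
def fint {n : ℕ} (u : (Fin (n + 1) → ℝ) → ℝ) (i : Fin (n + 1)) (xp : Fin n → ℝ) (s : ℝ)
    (yp : Fin n → ℝ) (t : ℝ) : ℝ :=
  ((uslice u i xp t - uslice u i xp s) - (uslice u i (xp + yp) t - uslice u i (xp + yp) s)) ^ 2

/-- The localized term `V_{i,τ}(u, x_i^⊥, I)`. -/
def Vloc (n : ℕ) (p β τ L : ℝ) (u : (Fin (n + 1) → ℝ) → ℝ) (i : Fin (n + 1)) (xp : Fin n → ℝ)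
    (I : Set ℝ) : ℝ :=
  (1 / (2 * ((n : ℝ) + 1))) *
    ∫ a in I, ∫ b : ℝ, ∫ sr in OmegaST L a b, ∫ yp : Fin n → ℝ,
      (Gfun L sr.2)⁻¹ * fint u i xp sr.1 yp (sr.1 + sr.2) *
        Ktau (n + 1) p β τ (i.insertNth sr.2 (yp - xp))

/-- The localized term `W_{i,τ}(u, x)`. -/
def WlocT (n : ℕ) (p β τ : ℝ) (u : (Fin (n + 1) → ℝ) → ℝ) (i : Fin (n + 1))
    (x : Fin (n + 1) → ℝ) : ℝ :=
  (1 / (2 * ((n : ℝ) + 1))) *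
    ∫ y : Fin (n + 1) → ℝ,
      fint u i (i.removeNth x) (x i) (i.removeNth y) (y i) * Ktau (n + 1) p β τ (y - x)

/-- The localized lower-bound energy `F̄_{i,τ,ε}(u, Q_l(z))`. -/
def FbarI (n : ℕ) (p β τ ε L l : ℝ) (u : (Fin (n + 1) → ℝ) → ℝ) (i : Fin (n + 1))
    (z : Fin (n + 1) → ℝ) : ℝ :=
  (1 / l ^ (n + 1)) *
      (∫ xp in Qperp n l (i.removeNth z),
        Rloc n p β τ ε L u i xp (Set.Ioo (z i - l / 2) (z i + l / 2))) +
    (1 / l ^ (n + 1)) *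
      (∫ xp in Qperp n l (i.removeNth z),
        Vloc n p β τ L u i xp (Set.Ioo (z i - l / 2) (z i + l / 2))) +
    (1 / l ^ (n + 1)) * (∫ x in Qc (n + 1) l z, WlocT n p β τ u i x) +
    (3 * (Ctau n p β τ - 1) / (((n : ℝ) + 1) * l ^ (n + 1))) *
      ∫ x in Qc (n + 1) l z ∩ {x | gradv u x = 0}, Wpot (u x) / alphaET β τ ε

/-- `F̄_{τ,ε}(u, Q_l(z)) = ∑ᵢ F̄_{i,τ,ε}(u, Q_l(z))`. -/
def FbarSum (n : ℕ) (p β τ ε L l : ℝ) (u : (Fin (n + 1) → ℝ) → ℝ) (z : Fin (n + 1) → ℝ) : ℝ :=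
  ∑ i, FbarI n p β τ ε L l u i z

/-- Admissible stripe sets: unions of stripes with boundaries orthogonal to `e_i`, whose
boundary components are at distance at least `η`. -/
def StripeAdm (n : ℕ) (i : Fin (n + 1)) (η : ℝ) (F : Set (Fin (n + 1) → ℝ)) : Prop :=
  ∃ Ehat : Set ℝ, MeasurableSet Ehat ∧ F = {x | x i ∈ Ehat} ∧
    ∀ a ∈ frontier Ehat, ∀ b ∈ frontier Ehat, a ≠ b → η ≤ |a - b|

/-- `D^i_η(u, Q_l(z))`. -/
def DistI (n : ℕ) (i : Fin (n + 1)) (η : ℝ) (u : (Fin (n + 1) → ℝ) → ℝ) (z : Fin (n + 1) → ℝ)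
    (l : ℝ) : ℝ :=
  sInf {r | ∃ F, StripeAdm n i η F ∧
    r = (1 / l ^ (n + 1)) * ∫ x in Qc (n + 1) l z, |u x - Set.indicator F (fun _ => (1 : ℝ)) x|}

/-- `D_η(u, Q_l(z)) = min_i D^i_η(u, Q_l(z))`. -/
def DistMin (n : ℕ) (η : ℝ) (u : (Fin (n + 1) → ℝ) → ℝ) (z : Fin (n + 1) → ℝ) (l : ℝ) : ℝ :=
  ⨅ i : Fin (n + 1), DistI n i η u z l

/-- Conclusion of the positivity lemma for concentrated Modica–Mortola energy. -/
def PosConcl (n : ℕ) (p β ε L η₀ Υ τ : ℝ) : Prop :=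
  ∀ k : ℝ, 1 ≤ k → ∀ u, AdmPer (n + 1) L u →
    ∀ i : Fin (n + 1), ∀ xp : Fin n → ℝ, (∀ j, xp j ∈ Set.Ico (0 : ℝ) L) →
      ∀ abar ∈ Set.Ico (0 : ℝ) L,
        k * Υ ≤ Mbar n (alphaET β τ ε) u i xp (abar - η₀) (abar + η₀) →
        k * Υ ≤ Rloc n p β τ ε L u i xp (Set.Ioo (abar - η₀ / 2) (abar + η₀ / 2))

/-- `η₀, τ₀` are as in the positivity lemma for concentrated Modica–Mortola energy. -/
def PosLemmaProp (n : ℕ) (p β ε L η₀ τ₀ Υ : ℝ) : Prop :=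
  0 < η₀ ∧ 0 < τ₀ ∧ τ₀ ^ (1 / β) ≤ η₀ ∧ ∀ τ, 0 < τ → τ ≤ τ₀ → PosConcl n p β ε L η₀ Υ τ

/-- Conclusion of the positivity lemma for bounded oscillations. -/
def OscConcl (n : ℕ) (p β ε L δ δ₀ τ : ℝ) : Prop :=
  ∀ u, AdmPer (n + 1) L u →
    ∀ i : Fin (n + 1), ∀ xp : Fin n → ℝ, (∀ j, xp j ∈ Set.Ico (0 : ℝ) L) →
      ∀ abar ∈ Set.Ico (0 : ℝ) L, ∀ c : ℝ, 0 < c →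
        (∀ s ρ : ℝ, s ∈ Set.Icc (abar - c - δ₀ / 2) (abar + c + δ₀ / 2) →
            s + ρ ∈ Set.Icc (abar - c - δ₀ / 2) (abar + c + δ₀ / 2) → |ρ| ≤ δ₀ →
            |uslice u i xp s - uslice u i xp (s + ρ)| ≤ 1 - δ) →
        0 < Rloc n p β τ ε L u i xp (Set.Ioo (abar - c) (abar + c))

/-- `τ₁` is as in the positivity lemma for bounded oscillations. -/
def OscLemmaProp (n : ℕ) (p β ε L δ δ₀ τ₁ : ℝ) : Prop :=
  0 < τ₁ ∧ ∀ τ, 0 < τ → τ ≤ τ₁ → τ ^ (1 / β) ≤ δ₀ → OscConcl n p β ε L δ δ₀ τ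

/-- Divergence of a vector field. -/
def divg {d : ℕ} (φ : (Fin d → ℝ) → Fin d → ℝ) (x : Fin d → ℝ) : ℝ :=
  ∑ j, fderiv ℝ (fun y => φ y j) x (ee d j)

/-- Dual formulation of the anisotropic `1`-perimeter relative to `[0,L)^d`. -/
def Per1Set (d : ℕ) (L : ℝ) (E : Set (Fin d → ℝ)) : Set ℝ :=
  {r | ∃ φ : (Fin d → ℝ) → Fin d → ℝ, ContDiff ℝ 1 φ ∧
    (∀ x, x ∉ interior (cube d L) → φ x = 0) ∧ (∀ x j, |φ x j| ≤ 1) ∧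
    r = ∫ x in E, divg φ x}

/-- Anisotropic `1`-perimeter relative to `[0,L)^d`. -/
def Per1 (d : ℕ) (L : ℝ) (E : Set (Fin d → ℝ)) : ℝ := sSup (Per1Set d L E)

/-- Locally finite (anisotropic) perimeter. -/
def LocallyFinitePer (d : ℕ) (E : Set (Fin d → ℝ)) : Prop :=
  ∀ L, 0 < L → BddAbove (Per1Set d L E)

/-- `[0,L)^d`-periodic set. -/
def PeriodicSet (d : ℕ) (L : ℝ) (E : Set (Fin d → ℝ)) : Prop :=
  ∀ j : Fin d, (fun x => x + L • ee d j) ⁻¹' E = E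

/-- Sharp interface functional `F_{τ,L}` in dimension `d = n+1`. -/
def Fsharp (n : ℕ) (p β τ L : ℝ) (E : Set (Fin (n + 1) → ℝ)) : ℝ :=
  (Per1 (n + 1) L E * ((∫ ζ : Fin (n + 1) → ℝ, Ktau (n + 1) p β τ ζ * |ζ 0|) - 1) -
      ∫ ζ : Fin (n + 1) → ℝ, ∫ x in cube (n + 1) L,
        |Set.indicator E (fun _ => (1 : ℝ)) x - Set.indicator E (fun _ => (1 : ℝ)) (x + ζ)| *
          Ktau (n + 1) p β τ ζ) / L ^ (n + 1)

/-- `E` is, up to null sets (in `[0,L)^d`), a periodic union of stripes. -/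
def IsStripesUnion (n : ℕ) (L : ℝ) (E : Set (Fin (n + 1) → ℝ)) : Prop :=
  ∃ i : Fin (n + 1), ∃ h ν : ℝ, 0 < h ∧ ∃ N : ℕ,
    volume (symmDiff E {x : Fin (n + 1) → ℝ |
      x i ∈ ⋃ k ∈ Finset.range (N + 1),
        Set.Ioo (2 * (k : ℝ) * h + ν) ((2 * (k : ℝ) + 1) * h + ν)} ∩ cube (n + 1) L) = 0

lemma aux_exp1 (s : ℝ) (hs : 0 < s) : ∫ x : ℝ, Real.exp (-s * |x|) = 2 / s := by
  rw [integral_comp_abs (f := fun x => Real.exp (-s * x)), integral_exp_mul_Ioi (by linarith)]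
  simp
  field_simp

lemma aux_expn (n : ℕ) (s : ℝ) (hs : 0 < s) :
    ∫ ζ : Fin n → ℝ, Real.exp (-s * norm1 ζ) = (2 / s) ^ n := by
  have h : ∀ ζ : Fin n → ℝ, Real.exp (-s * norm1 ζ) = ∏ i, Real.exp (-s * |ζ i|) := by
    intro ζ
    rw [norm1, Finset.mul_sum, Real.exp_sum]
  simp_rw [h]
  rw [integral_fintype_prod_volume_eq_pow (fun x : ℝ => Real.exp (-s * |x|)), aux_exp1 s hs]
  simp

lemma aux_gamma (p A : ℝ) (hp : 0 < p) (hA : 0 < A) :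
    ∫ s in Ioi (0 : ℝ), s ^ (p - 1) * Real.exp (-(A * s)) / Real.Gamma p = A ^ (-p) := by
  rw [integral_div, Real.integral_rpow_mul_exp_neg_mul_Ioi hp hA]
  have := Real.Gamma_pos_of_pos hp
  rw [mul_div_assoc, div_self this.ne', mul_one, one_div, Real.inv_rpow hA.le, Real.rpow_neg hA.le]

lemma norm1_nonneg {n : ℕ} (ζ : Fin n → ℝ) : 0 ≤ norm1 ζ :=
  Finset.sum_nonneg fun _ _ => abs_nonneg _

lemma norm1_meas (n : ℕ) : Measurable (fun ζ : Fin n → ℝ => norm1 ζ) := by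
  unfold norm1; fun_prop

/-- reflection positivity of the kernel `K_τ`: the one-variable marginal
`K̂_τ` is the Laplace transform of a nonnegative function.  Ambient dimension `d = n+1`,
so the marginal integrates out `n` variables. -/
theorem statement3 (n : ℕ) (p β τ : ℝ) (hp : (n : ℝ) + 3 ≤ p) (hβ : β = p - (n : ℝ) - 2)
    (hτ : 0 < τ) :
    ∃ g : ℝ → ℝ, Measurable g ∧ (∀ s, 0 ≤ g s) ∧
      ∀ t : ℝ, Khat n p β τ t = ∫ s in Set.Ioi (0 : ℝ), Real.exp (-|t| * s) * g s := by
  have ha : 0 < τ ^ (1 / β) := Real.rpow_pos_of_pos hτ _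
  set a := τ ^ (1 / β) with ha'
  have hn : (0 : ℝ) ≤ n := Nat.cast_nonneg n
  have hp0 : 0 < p := by linarith
  have hG := Real.Gamma_pos_of_pos hp0
  refine ⟨fun s => if 0 < s then s ^ (p - 1) * Real.exp (-(a * s)) / Real.Gamma p * (2 / s) ^ n
    else 0, ?_, ?_, ?_⟩
  · exact Measurable.ite measurableSet_Ioi (by fun_prop) measurable_const
  · intro s
    dsimp only
    split_ifs with h
    · positivity
    · exact le_rfl
  intro t
  have ht := abs_nonneg t
  set F : (Fin n → ℝ) → ℝ → ℝ := fun ζ s =>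
    s ^ (p - 1) * Real.exp (-((|t| + a) * s)) / Real.Gamma p * Real.exp (-s * norm1 ζ) with hF
  have hFint : ∀ s ∈ Ioi (0 : ℝ), ∫ ζ : Fin n → ℝ, F ζ s =
      s ^ (p - 1) * Real.exp (-((|t| + a) * s)) / Real.Gamma p * (2 / s) ^ n := by
    intro s hs
    simp only [hF]
    rw [integral_const_mul, aux_expn n s hs]
  have hnm := norm1_meas n
  have hint : Integrable (Function.uncurry F)
      ((volume : Measure (Fin n → ℝ)).prod (volume.restrict (Ioi (0 : ℝ)))) := by
    have hm : Measurable (Function.uncurry F) := by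
      simp only [hF, Function.uncurry_def]
      have : Measurable (fun x : (Fin n → ℝ) × ℝ => norm1 x.1) := hnm.comp measurable_fst
      fun_prop
    rw [integrable_prod_iff' hm.aestronglyMeasurable]
    constructor
    · refine (ae_restrict_iff' measurableSet_Ioi).2 (Filter.Eventually.of_forall fun s hs => ?_)
      have hs' : (0 : ℝ) < s := hs
      by_contra hcon
      have h0 := integral_undef hcon
      have h1 := hFint s hs
      simp only [Function.uncurry] at h0
      rw [h0] at h1
      have : 0 < s ^ (p - 1) * Real.exp (-((|t| + a) * s)) / Real.Gamma p * (2 / s) ^ n := by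
        positivity
      linarith
    · have hI : IntegrableOn (fun s : ℝ => (2 ^ n / Real.Gamma p) *
          (s ^ ((p - n) - 1) * Real.exp (-((|t| + a) * s)))) (Ioi 0) := by
        refine Integrable.const_mul ?_ _
        by_contra hcon
        have h0 := integral_undef hcon
        rw [Real.integral_rpow_mul_exp_neg_mul_Ioi (by linarith) (by linarith)] at h0
        have h2 := Real.Gamma_pos_of_pos (show 0 < p - n by linarith)
        have : 0 < (1 / (|t| + a)) ^ (p - n) * Real.Gamma (p - n) := by positivity
        linarith
      refine hI.congr_fun (fun s hs => ?_) measurableSet_Ioi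
      have hs' : (0 : ℝ) < s := hs
      have hnn : ∀ ζ, ‖Function.uncurry F (ζ, s)‖ = F ζ s := by
        intro ζ
        simp only [Function.uncurry, hF]
        rw [Real.norm_of_nonneg]
        positivity
      simp only [hnn]
      rw [hFint s hs, show p - n - 1 = (p - 1) - n by ring, Real.rpow_sub hs', Real.rpow_natCast,
        div_pow]
      field_simp
  calc Khat n p β τ t = ∫ ζ : Fin n → ℝ, ∫ s in Ioi (0 : ℝ), F ζ s := by
        unfold Khat
        refine integral_congr_ae (Filter.Eventually.of_forall fun ζ => ?_)
        have hz := norm1_nonneg ζ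
        dsimp only
        rw [← ha', ← aux_gamma p _ hp0 (by linarith)]
        refine setIntegral_congr_fun measurableSet_Ioi fun s hs => ?_
        simp only [hF]
        rw [show -((|t| + norm1 ζ + a) * s) = -((|t| + a) * s) + -s * norm1 ζ by ring,
          Real.exp_add]
        ring
    _ = ∫ s in Ioi (0 : ℝ), ∫ ζ : Fin n → ℝ, F ζ s := integral_integral_swap hint
    _ = _ := by
        refine setIntegral_congr_fun measurableSet_Ioi fun s hs => ?_
        have hs' : (0 : ℝ) < s := hs
        dsimp only
        rw [hFint s hs, if_pos hs',
          show -((|t| + a) * s) = -|t| * s + -(a * s) by ring, Real.exp_add]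
        ring
end
end

section
/- There exists a constant C_d, depending only on the dimension d, such that for every measurable u : ℝ^d → [0,1], every η > 0 and l > 0, the map z ↦ D_η(u, Q_l(z)) is Lipschitz on ℝ^d with Lipschitz constant C_d / l. -/
open MeasureTheory Real Set

noncomputable section

theorem aux_Qc (n : ℕ) (l : ℝ) (hl : 0 ≤ l) (z : Fin (n + 1) → ℝ) :
    Qc (n + 1) l z = Metric.closedBall z (l / 2) := by
  ext x
  simp only [Qc, Set.mem_setOf_eq, Metric.mem_closedBall]
  rw [dist_pi_le_iff (by linarith)]
  simp only [Real.dist_eq]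

theorem aux_vol (n : ℕ) (r : ℝ) (hr : 0 ≤ r) (z : Fin (n + 1) → ℝ) :
    volume.real (Metric.closedBall z (r / 2)) = r ^ (n + 1) := by
  rw [measureReal_def, Real.volume_pi_closedBall z (by linarith), ENNReal.toReal_ofReal (by positivity)]
  rw [Fintype.card_fin]
  congr 1
  ring

theorem aux_int (n : ℕ) (f : (Fin (n + 1) → ℝ) → ℝ) (hf : Measurable f)
    (h0 : ∀ x, 0 ≤ f x) (h1 : ∀ x, f x ≤ 1) (l : ℝ) (hl : 0 < l) (z z' : Fin (n + 1) → ℝ) :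
    (1 / l ^ (n + 1)) * ∫ x in Qc (n + 1) l z, f x ≤
      (1 / l ^ (n + 1)) * (∫ x in Qc (n + 1) l z', f x) + ((n : ℝ) + 1) / l * dist z z' := by
  rw [aux_Qc n l hl.le, aux_Qc n l hl.le]
  have hint : ∀ (w : Fin (n + 1) → ℝ) (r : ℝ), IntegrableOn f (Metric.closedBall w r) := by
    intro w r
    refine Measure.integrableOn_of_bounded (M := 1) measure_closedBall_lt_top.ne
      hf.aestronglyMeasurable ?_
    filter_upwards with x
    rw [Real.norm_eq_abs, abs_of_nonneg (h0 x)]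
    exact h1 x
  have hbd : ∀ s : Set (Fin (n + 1) → ℝ), volume s ≠ ⊤ → ∫ x in s, f x ≤ volume.real s := by
    intro s hs
    have := norm_setIntegral_le_of_norm_le_const (μ := volume) (s := s) (f := f) (C := 1)
      hs.lt_top (fun x _ => by
        rw [Real.norm_eq_abs, abs_of_nonneg (h0 x)]
        exact h1 x)
    rw [one_mul] at this
    exact (le_abs_self _).trans this
  have hpow : 0 < l ^ (n + 1) := by positivity
  have hnn : 0 ≤ ∫ x in Metric.closedBall z' (l / 2), f x := integral_nonneg h0
  have hd : 0 ≤ dist z z' := dist_nonneg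
  rcases le_total l (dist z z') with hc | hc
  · have hA := hbd _ (measure_closedBall_lt_top (μ := volume) (x := z) (r := l / 2)).ne
    rw [aux_vol n l hl.le] at hA
    have e1 : (1 / l ^ (n + 1)) * ∫ x in Metric.closedBall z (l / 2), f x ≤ 1 := by
      rw [one_div, inv_mul_le_iff₀ hpow]; linarith
    have e2 : 0 ≤ (1 / l ^ (n + 1)) * ∫ x in Metric.closedBall z' (l / 2), f x := by positivity
    have e3 : 1 ≤ ((n : ℝ) + 1) / l * dist z z' := by
      rw [div_mul_eq_mul_div, le_div_iff₀ hl]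
      nlinarith [(Nat.cast_nonneg n : (0 : ℝ) ≤ n)]
    linarith
  · set δ := dist z z' with hδ
    set m := midpoint ℝ z z' with hm
    have s1 : Metric.closedBall m ((l - δ) / 2) ⊆ Metric.closedBall z (l / 2) := by
      apply Metric.closedBall_subset_closedBall'
      rw [hm, dist_midpoint_left]
      rw [Real.norm_of_nonneg (by norm_num), ← hδ]
      linarith
    have s2 : Metric.closedBall m ((l - δ) / 2) ⊆ Metric.closedBall z' (l / 2) := by
      apply Metric.closedBall_subset_closedBall'
      rw [hm, dist_midpoint_right]
      rw [Real.norm_of_nonneg (by norm_num), ← hδ]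
      linarith
    have e1 := setIntegral_mono_set (μ := volume) (hint z' (l / 2))
      (Filter.Eventually.of_forall h0) s2.eventuallyLE
    have e2 := integral_diff (μ := volume) (f := f)
      (Metric.isClosed_closedBall (x := m) (ε := (l - δ) / 2)).measurableSet
      (hint z (l / 2)) s1
    have e3 := hbd (Metric.closedBall z (l / 2) \ Metric.closedBall m ((l - δ) / 2))
      (measure_ne_top_of_subset diff_subset measure_closedBall_lt_top.ne)
    rw [measureReal_diff s1 Metric.isClosed_closedBall.measurableSet
      measure_closedBall_lt_top.ne,
      aux_vol n l hl.le, aux_vol n (l - δ) (by linarith)] at e3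
    have e4 : l ^ (n + 1) * (1 - ((n : ℝ) + 1) / l * δ) ≤ (l - δ) ^ (n + 1) := by
      have hb := one_add_mul_le_pow (a := -(δ / l)) (by
        have : δ / l ≤ 1 := (div_le_one hl).2 hc
        linarith) (n + 1)
      have h2 : (l - δ) = l * (1 + -(δ / l)) := by field_simp; ring
      rw [h2, mul_pow]
      apply mul_le_mul_of_nonneg_left _ hpow.le
      refine le_trans (le_of_eq ?_) hb
      push_cast
      ring
    have e5 : ∫ x in Metric.closedBall z (l / 2), f x ≤
        (∫ x in Metric.closedBall z' (l / 2), f x) + l ^ (n + 1) * (((n : ℝ) + 1) / l * δ) := by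
      linarith
    calc _ ≤ (1 / l ^ (n + 1)) * ((∫ x in Metric.closedBall z' (l / 2), f x) +
            l ^ (n + 1) * (((n : ℝ) + 1) / l * δ)) :=
          mul_le_mul_of_nonneg_left e5 (by positivity)
      _ = _ := by
          rw [mul_add, ← mul_assoc (1 / l ^ (n + 1)), one_div_mul_cancel hpow.ne', one_mul]

theorem aux_DistI (n : ℕ) (i : Fin (n + 1)) (u : (Fin (n + 1) → ℝ) → ℝ) (hu : Measurable u)
    (hu1 : ∀ x, u x ∈ Set.Icc (0 : ℝ) 1) (η l : ℝ) (hl : 0 < l) (z z' : Fin (n + 1) → ℝ) :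
    DistI n i η u z l ≤ DistI n i η u z' l + ((n : ℝ) + 1) / l * dist z z' := by
  rw [← sub_le_iff_le_add]
  unfold DistI
  apply le_csInf
  · exact ⟨_, ∅, ⟨∅, MeasurableSet.empty, by simp, by simp⟩, rfl⟩
  · rintro r ⟨F, hF, rfl⟩
    rw [sub_le_iff_le_add]
    have hFm : MeasurableSet F := by
      obtain ⟨E, hE, rfl, -⟩ := hF
      exact (measurable_pi_apply i) hE
    have hb : BddBelow {r | ∃ F, StripeAdm n i η F ∧
        r = (1 / l ^ (n + 1)) *
          ∫ x in Qc (n + 1) l z, |u x - Set.indicator F (fun _ => (1 : ℝ)) x|} := by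
      refine ⟨0, ?_⟩
      rintro r ⟨F, -, rfl⟩
      have : 0 ≤ ∫ x in Qc (n + 1) l z, |u x - Set.indicator F (fun _ => (1 : ℝ)) x| :=
        integral_nonneg (fun x => abs_nonneg _)
      positivity
    refine (csInf_le hb ⟨F, hF, rfl⟩).trans ?_
    apply aux_int n _ _ (fun x => abs_nonneg _) _ l hl
    · exact (hu.sub (measurable_const.indicator hFm)).abs
    · intro x
      obtain ⟨h0, h1⟩ := hu1 x
      by_cases hx : x ∈ F
      · simp only [Set.indicator_of_mem hx]
        rw [abs_le]; constructor <;> linarith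
      · simp only [Set.indicator_of_notMem hx]
        rw [abs_le]; constructor <;> linarith

theorem aux_DistMin (n : ℕ) (u : (Fin (n + 1) → ℝ) → ℝ) (hu : Measurable u)
    (hu1 : ∀ x, u x ∈ Set.Icc (0 : ℝ) 1) (η l : ℝ) (hl : 0 < l) (z z' : Fin (n + 1) → ℝ) :
    DistMin n η u z l ≤ DistMin n η u z' l + ((n : ℝ) + 1) / l * dist z z' := by
  rw [← sub_le_iff_le_add]
  apply le_ciInf
  intro i
  rw [sub_le_iff_le_add]
  exact (ciInf_le (Set.finite_range _).bddBelow i).trans (aux_DistI n i u hu hu1 η l hl z z')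

/-- Remark 7.4(i): `z ↦ D_η(u, Q_l(z))` is Lipschitz with constant `C_d/l`,
where `C_d` depends only on the dimension.  (The distance on `ℝ^d = Fin (n+1) → ℝ` is the
sup distance.) -/
theorem statement6 (n : ℕ) :
    ∃ C : ℝ, 0 < C ∧
      ∀ u : (Fin (n + 1) → ℝ) → ℝ, Measurable u → (∀ x, u x ∈ Set.Icc (0 : ℝ) 1) →
        ∀ η l : ℝ, 0 < η → 0 < l →
          ∀ z z' : Fin (n + 1) → ℝ,
            |DistMin n η u z l - DistMin n η u z' l| ≤ C / l * dist z z' := by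
  refine ⟨(n : ℝ) + 1, by positivity, ?_⟩
  intro u hu hu1 η l _ hl z z'
  have h1 := aux_DistMin n u hu hu1 η l hl z z'
  have h2 := aux_DistMin n u hu hu1 η l hl z' z
  rw [dist_comm z' z] at h2
  rw [abs_le]
  constructor <;> linarith
end
end

section
/- For every ν > 0 there exists σ₀ = σ₀(ν) > 0 such that for every σ ≤ σ₀, whenever a measurable u : ℝ^d → [0,1] satisfies D^j_η(u, Q_l(z)) ≤ σ and D^i_η(u, Q_l(z)) ≤ σ for some i ≠ j and some η > 0, then min{ ‖u‖_{L¹(Q_l(z))}, ‖1 − u‖_{L¹(Q_l(z))} } ≤ ν l^d. -/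
open MeasureTheory Real Set

noncomputable section

def rr {n : ℕ} (l : ℝ) (z : Fin (n+1) → ℝ) (k : Fin (n+1)) (T : Set ℝ) : ℝ :=
  volume.real (Set.Icc (z k - l/2) (z k + l/2) ∩ T) / l

lemma rr_univ {n : ℕ} {l : ℝ} (hl : 0 < l) (z : Fin (n+1) → ℝ) (k : Fin (n+1)) :
    rr l z k Set.univ = 1 := by
  unfold rr
  rw [Set.inter_univ, Real.volume_real_Icc_of_le (by linarith)]
  field_simp
  ring

lemma rr_compl {n : ℕ} {l : ℝ} (hl : 0 < l) (z : Fin (n+1) → ℝ) (k : Fin (n+1)) {T : Set ℝ}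
    (hT : MeasurableSet T) : rr l z k Tᶜ = 1 - rr l z k T := by
  have h := rr_univ hl z k
  have h2 : volume.real (Set.Icc (z k - l/2) (z k + l/2) ∩ T) +
      volume.real (Set.Icc (z k - l/2) (z k + l/2) \ T) =
      volume.real (Set.Icc (z k - l/2) (z k + l/2)) :=
    measureReal_inter_add_diff hT (by simp)
  unfold rr at *
  rw [Set.inter_univ] at h
  rw [← h, ← h2, Set.diff_eq]
  ring

lemma rr_nonneg {n : ℕ} {l : ℝ} (hl : 0 < l) (z : Fin (n+1) → ℝ) (k : Fin (n+1)) (T : Set ℝ) :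
    0 ≤ rr l z k T := div_nonneg measureReal_nonneg hl.le

lemma vol_eq {n : ℕ} {l : ℝ} (hl : 0 < l) (z : Fin (n+1) → ℝ) {i j : Fin (n+1)} (hij : i ≠ j)
    (S T : Set ℝ) :
    volume.real ({x | x i ∈ S ∧ x j ∈ T} ∩ Qc (n+1) l z) =
      l ^ (n+1) * (rr l z i S * rr l z j T) := by
  classical
  set U : Fin (n+1) → Set ℝ := fun k => if k = i then S else if k = j then T else Set.univ with hU
  have hset : {x : Fin (n+1) → ℝ | x i ∈ S ∧ x j ∈ T} ∩ Qc (n+1) l z =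
      Set.pi Set.univ (fun k => Set.Icc (z k - l/2) (z k + l/2) ∩ U k) := by
    ext x
    simp only [Qc, Set.mem_inter_iff, Set.mem_setOf_eq, Set.mem_pi, Set.mem_univ, true_imp_iff,
      Set.mem_Icc, abs_le, hU]
    constructor
    · rintro ⟨⟨h1, h2⟩, h3⟩ k
      refine ⟨⟨by linarith [(h3 k).1], by linarith [(h3 k).2]⟩, ?_⟩
      split_ifs with a b
      · exact a ▸ h1
      · exact b ▸ h2
      · trivial
    · intro h
      refine ⟨⟨by simpa using (h i).2, by simpa [hij.symm] using (h j).2⟩, fun k => ?_⟩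
      exact ⟨by linarith [(h k).1.1], by linarith [(h k).1.2]⟩
  rw [hset, measureReal_def, volume_pi_pi, ENNReal.toReal_prod]
  have : ∀ k, (volume (Set.Icc (z k - l/2) (z k + l/2) ∩ U k)).toReal = l * rr l z k (U k) := by
    intro k
    unfold rr
    rw [measureReal_def]
    field_simp
  simp_rw [this]
  rw [Finset.prod_mul_distrib]
  simp only [Finset.prod_const, Finset.card_univ, Fintype.card_fin]
  congr 1
  rw [Finset.prod_eq_mul i j hij]
  · simp [hU, hij.symm]
  · intro k _ hk
    simp [hU, hk.1, hk.2, rr_univ hl]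
  · simp
  · simp

lemma get_set {n : ℕ} {i : Fin (n+1)} {η : ℝ} {u : (Fin (n+1) → ℝ) → ℝ} {z : Fin (n+1) → ℝ}
    {l σ : ℝ} (hl : 0 < l) (hσ : 0 < σ) (h : DistI n i η u z l ≤ σ) :
    ∃ E : Set ℝ, MeasurableSet E ∧ ∫ x in Qc (n + 1) l z,
      |u x - Set.indicator {x : Fin (n+1) → ℝ | x i ∈ E} (fun _ => (1 : ℝ)) x|
        ≤ 2 * σ * l ^ (n+1) := by
  unfold DistI at h
  have h' := lt_of_le_of_lt h (by linarith : σ < 2 * σ)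
  obtain ⟨r, ⟨F, ⟨E, hE, hF, -⟩, hr⟩, hlt⟩ := exists_lt_of_csInf_lt (by
    refine ⟨_, ∅, ⟨∅, MeasurableSet.empty, ?_, ?_⟩, rfl⟩ <;> simp) h'
  refine ⟨E, hE, ?_⟩
  subst hF
  have hp : 0 < l ^ (n+1) := by positivity
  rw [hr, one_div, inv_mul_lt_iff₀ hp] at hlt
  linarith

lemma main_aux {n : ℕ} {l σ : ℝ} (hl : 0 < l) (z : Fin (n+1) → ℝ)
    {u : (Fin (n+1) → ℝ) → ℝ} (hu : Measurable u) (hu1 : ∀ x, u x ∈ Set.Icc (0:ℝ) 1)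
    {i j : Fin (n+1)} (hij : i ≠ j) {E G : Set ℝ} (hE : MeasurableSet E) (hG : MeasurableSet G)
    (h1 : ∫ x in Qc (n + 1) l z,
      |u x - Set.indicator {x : Fin (n+1) → ℝ | x i ∈ E} (fun _ => (1 : ℝ)) x|
        ≤ 2 * σ * l ^ (n+1))
    (h2 : ∫ x in Qc (n + 1) l z,
      |u x - Set.indicator {x : Fin (n+1) → ℝ | x j ∈ G} (fun _ => (1 : ℝ)) x|
        ≤ 2 * σ * l ^ (n+1)) :
    min (∫ x in Qc (n + 1) l z, |u x|) (∫ x in Qc (n + 1) l z, |1 - u x|) ≤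
      10 * σ * l ^ (n + 1) := by
  classical
  have hp : 0 < l ^ (n+1) := by positivity
  set Q := Qc (n+1) l z with hQ
  have hQfin : volume Q < ⊤ := by
    have : Q = Set.pi Set.univ (fun k => Set.Icc (z k - l/2) (z k + l/2)) := by
      ext x
      simp only [hQ, Qc, Set.mem_setOf_eq, Set.mem_pi, Set.mem_univ, true_imp_iff,
        Set.mem_Icc, abs_le]
      exact forall_congr' fun k => ⟨fun h => ⟨by linarith [h.1], by linarith [h.2]⟩,
        fun h => ⟨by linarith [h.1], by linarith [h.2]⟩⟩
    rw [this, volume_pi_pi]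
    exact ENNReal.prod_lt_top (fun k _ => by simp)
  have hmS : ∀ (S T : Set ℝ), MeasurableSet S → MeasurableSet T →
      MeasurableSet {x : Fin (n+1) → ℝ | x i ∈ S ∧ x j ∈ T} := fun S T hS hT =>
    (measurable_pi_apply i hS).inter (measurable_pi_apply j hT)
  have hint : ∀ f : (Fin (n+1) → ℝ) → ℝ, Measurable f → (∀ x, |f x| ≤ 1) →
      Integrable f (volume.restrict Q) := fun f hf hb =>
    Measure.integrableOn_of_bounded hQfin.ne hf.aestronglyMeasurable
      (Filter.Eventually.of_forall (fun x => by simpa using hb x))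
  let I : Set ℝ → Set ℝ → (Fin (n+1) → ℝ) → ℝ := fun S T =>
    Set.indicator {x : Fin (n+1) → ℝ | x i ∈ S ∧ x j ∈ T} (fun _ => (1:ℝ))
  have hI : ∀ S T, MeasurableSet S → MeasurableSet T →
      ∫ x in Q, I S T x = l ^ (n+1) * (rr l z i S * rr l z j T) := by
    intro S T hS hT
    rw [← vol_eq hl z hij, integral_indicator (hmS S T hS hT),
      Measure.restrict_restrict (hmS S T hS hT)]
    simp [measureReal_def, hQ]
  have hIi : ∀ S T, MeasurableSet S → MeasurableSet T → Integrable (I S T) (volume.restrict Q) := by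
    intro S T hS hT
    refine hint _ (measurable_const.indicator (hmS S T hS hT)) fun x => ?_
    by_cases hx : x ∈ {x : Fin (n+1) → ℝ | x i ∈ S ∧ x j ∈ T} <;> simp [I, Set.indicator, hx] <;>
      split_ifs <;> simp
  have hf1 : Integrable (fun x => |u x - Set.indicator {x : Fin (n+1) → ℝ | x i ∈ E}
      (fun _ => (1 : ℝ)) x|) (volume.restrict Q) := by
    refine hint _ ((hu.sub (measurable_const.indicator (measurable_pi_apply i hE))).abs) fun x => ?_
    have := hu1 x
    simp only [Set.indicator, abs_abs]
    split_ifs <;> rw [abs_le] <;> constructor <;> linarith [this.1, this.2]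
  have hf2 : Integrable (fun x => |u x - Set.indicator {x : Fin (n+1) → ℝ | x j ∈ G}
      (fun _ => (1 : ℝ)) x|) (volume.restrict Q) := by
    refine hint _ ((hu.sub (measurable_const.indicator (measurable_pi_apply j hG))).abs) fun x => ?_
    have := hu1 x
    simp only [Set.indicator, abs_abs]
    split_ifs <;> rw [abs_le] <;> constructor <;> linarith [this.1, this.2]
  have hu_i : Integrable (fun x => |u x|) (volume.restrict Q) := by
    refine hint _ hu.abs fun x => ?_
    have := hu1 x
    rw [abs_abs, abs_le]; constructor <;> linarith [this.1, this.2]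
  have hu_i2 : Integrable (fun x => |1 - u x|) (volume.restrict Q) := by
    refine hint _ (measurable_const.sub hu).abs fun x => ?_
    have := hu1 x
    rw [abs_abs, abs_le]; constructor <;> linarith [this.1, this.2]
  have k1 := integral_mono ((hIi E Gᶜ hE hG.compl).add (hIi Eᶜ G hE.compl hG)) (hf1.add hf2)
    (by
      intro x
      have := hu1 x
      simp only [I, Pi.add_apply, Set.indicator, Set.mem_setOf_eq, Set.mem_compl_iff]
      by_cases a : x i ∈ E <;> by_cases b : x j ∈ G <;>
        simp only [a, b, not_true_eq_false, not_false_eq_true, and_true, and_false, if_true,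
          if_false] <;>
        cases abs_cases (u x - 1) <;> cases abs_cases (u x - 0) <;> linarith [this.1, this.2])
  have k2 := integral_mono hu_i (hf1.add (hIi E Set.univ hE MeasurableSet.univ))
    (by
      intro x
      have := hu1 x
      simp only [I, Pi.add_apply, Set.indicator, Set.mem_setOf_eq, Set.mem_univ, and_true]
      by_cases a : x i ∈ E <;>
        simp only [a, if_true, if_false] <;>
        cases abs_cases (u x - 1) <;> cases abs_cases (u x - 0) <;> cases abs_cases (u x) <;>
          linarith [this.1, this.2])
  have k3 := integral_mono hu_i2 (hf1.add (hIi Eᶜ Set.univ hE.compl MeasurableSet.univ))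
    (by
      intro x
      have := hu1 x
      simp only [I, Pi.add_apply, Set.indicator, Set.mem_setOf_eq, Set.mem_univ, and_true,
        Set.mem_compl_iff]
      by_cases a : x i ∈ E <;>
        simp only [a, if_true, if_false, not_true_eq_false, not_false_eq_true] <;>
        cases abs_cases (u x - 1) <;> cases abs_cases (u x - 0) <;> cases abs_cases (1 - u x) <;>
          linarith [this.1, this.2])
  simp only [Pi.add_apply] at k1 k2 k3
  rw [integral_add (hIi E Gᶜ hE hG.compl) (hIi Eᶜ G hE.compl hG), integral_add hf1 hf2,
    hI _ _ hE hG.compl, hI _ _ hE.compl hG, rr_compl hl z i hE, rr_compl hl z j hG] at k1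
  rw [integral_add hf1 (hIi E Set.univ hE MeasurableSet.univ),
    hI _ _ hE MeasurableSet.univ, rr_univ hl] at k2
  rw [integral_add hf1 (hIi Eᶜ Set.univ hE.compl MeasurableSet.univ),
    hI _ _ hE.compl MeasurableSet.univ, rr_univ hl, rr_compl hl z i hE] at k3
  have a0 := rr_nonneg hl z i E
  have b0 := rr_nonneg hl z j G
  have a1 := rr_nonneg hl z i Eᶜ
  have b1 := rr_nonneg hl z j Gᶜ
  rw [rr_compl hl z i hE] at a1
  rw [rr_compl hl z j hG] at b1
  generalize rr l z i E = a at *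
  generalize rr l z j G = b at *
  generalize l ^ (n+1) = V at *
  have k4 : a * (1 - b) + (1 - a) * b ≤ 4 * σ := by
    refine le_of_mul_le_mul_left ?_ hp
    linarith
  rcases le_total b (1/2) with hb | hb
  · refine (min_le_left _ _).trans ?_
    have : a ≤ 8 * σ := by nlinarith
    nlinarith
  · refine (min_le_right _ _).trans ?_
    have : 1 - a ≤ 8 * σ := by nlinarith
    nlinarith

/-- Remark 7.4(ii): closeness to stripes in two different directions forces
`u` to be `L¹`-close to one of the constants `0` or `1` on the cube. -/
theorem statement7 (n : ℕ) :
    ∀ ν : ℝ, 0 < ν → ∃ σ₀ : ℝ, 0 < σ₀ ∧ ∀ σ : ℝ, 0 < σ → σ ≤ σ₀ →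
      ∀ u : (Fin (n + 1) → ℝ) → ℝ, Measurable u → (∀ x, u x ∈ Set.Icc (0 : ℝ) 1) →
        ∀ (z : Fin (n + 1) → ℝ) (l η : ℝ), 0 < l → 0 < η →
          ∀ i j : Fin (n + 1), i ≠ j →
            DistI n i η u z l ≤ σ → DistI n j η u z l ≤ σ →
            min (∫ x in Qc (n + 1) l z, |u x|) (∫ x in Qc (n + 1) l z, |1 - u x|) ≤
              ν * l ^ (n + 1) := by
  intro ν hν
  refine ⟨ν / 10, by positivity, ?_⟩
  intro σ hσ hσ0 u hu hu1 z l η hl _ i j hij hi hj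
  obtain ⟨E, hE, h1⟩ := get_set hl hσ hi
  obtain ⟨G, hG, h2⟩ := get_set hl hσ hj
  refine (main_aux hl z hu hu1 hij hE hG h1 h2).trans ?_
  exact mul_le_mul_of_nonneg_right (by linarith) (by positivity)
end
end
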